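/- arXiv:2006.14502 — 2 statements merged into one kernel-verified Lean document; each statement's English description precedes it below -/
import Mathlib

section
/- Let (u, p, v) be a C^∞ solution of the stationary simplified Ericksen–Leslie system on ℝ³ with |v(x)| = 1 for all x, and let 3 ≤ p < +∞. Then there exists a constant c > 0, independent of R, such that for all R ≥ 1: ∫_{B_{R/2}} |∇u|² dx ≤ c [ (∫_{C(R/2,R)} |u|^p dx)^{2/p} + (∫_{C(R/2,R)} |∇v|^p dx)^{2/p} + (∫_{C(R/2,R)} |p|^{p/2} dx)^{2/p} ] · R^{2−9/p} · (∫_{C(R/2,R)} |u|^p dx)^{1/p} + (c/R²) ∫_{C(R/2,R)} |u|² dx, where |∇u|² = Σ_{i,j} (∂_j u_i)² and |∇v|² = Σ_{i,k} (∂_i v_k)². -/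
open MeasureTheory Filter Metric Real

noncomputable section

/-- Three-dimensional Euclidean space. -/
abbrev E3 : Type := EuclideanSpace ℝ (Fin 3)

/-- Partial derivative `∂_j f` of a scalar field. -/
def pd (j : Fin 3) (f : E3 → ℝ) (x : E3) : ℝ :=
  fderiv ℝ f x (EuclideanSpace.single j 1)

/-- Laplacian of a scalar field. -/
def lap (f : E3 → ℝ) (x : E3) : ℝ := ∑ j, pd j (pd j f) x

/-- The annulus `C(R/2, R)`. -/
def ann (R : ℝ) : Set E3 := {x : E3 | R / 2 < ‖x‖ ∧ ‖x‖ < R}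

/-- Euclidean length `|u(x)|` of a vector field. -/
def vecNorm (u : E3 → Fin 3 → ℝ) (x : E3) : ℝ := Real.sqrt (∑ i, (u x i) ^ 2)

/-- `|∇v|² = Σ_{i,k} (∂_i v_k)²`. -/
def gradSq (v : E3 → Fin 3 → ℝ) (x : E3) : ℝ :=
  ∑ i, ∑ k, (pd i (fun y => v y k) x) ^ 2

/-- The stationary simplified Ericksen–Leslie system:
`−Δu + (u·∇)u + div(∇v ⊙ ∇v) + ∇p = 0`, `−Δv + (u·∇)v − |∇v|² v = 0`, `div u = 0`. -/
def StatEL (u : E3 → Fin 3 → ℝ) (P : E3 → ℝ) (v : E3 → Fin 3 → ℝ) : Prop :=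
  (∀ x : E3, ∀ i : Fin 3,
    -(lap (fun y => u y i) x) + (∑ j, u x j * pd j (fun y => u y i) x)
      + (∑ j, ∑ k, pd j (fun y => pd i (fun z => v z k) y * pd j (fun z => v z k) y) x)
      + pd i P x = 0) ∧
  (∀ x : E3, ∀ i : Fin 3,
    -(lap (fun y => v y i) x) + (∑ j, u x j * pd j (fun y => v y i) x)
      - gradSq v x * v x i = 0) ∧
  (∀ x : E3, ∑ j, pd j (fun y => u y j) x = 0)

lemma pd_add (j : Fin 3) {f g : E3 → ℝ} (hf : Differentiable ℝ f) (hg : Differentiable ℝ g)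
    (x : E3) : pd j (fun y => f y + g y) x = pd j f x + pd j g x := by
  simp [pd, fderiv_fun_add (hf x) (hg x)]

lemma pd_sub (j : Fin 3) {f g : E3 → ℝ} (hf : Differentiable ℝ f) (hg : Differentiable ℝ g)
    (x : E3) : pd j (fun y => f y - g y) x = pd j f x - pd j g x := by
  simp [pd, fderiv_fun_sub (hf x) (hg x)]

lemma pd_mul (j : Fin 3) {f g : E3 → ℝ} (hf : Differentiable ℝ f) (hg : Differentiable ℝ g)
    (x : E3) : pd j (fun y => f y * g y) x = pd j f x * g x + f x * pd j g x := by
  simp [pd, fderiv_fun_mul (hf x) (hg x)]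
  ring

lemma pd_sum (j : Fin 3) {ι : Type*} (s : Finset ι) {f : ι → E3 → ℝ}
    (hf : ∀ i, Differentiable ℝ (f i)) (x : E3) :
    pd j (fun y => ∑ i ∈ s, f i y) x = ∑ i ∈ s, pd j (f i) x := by
  simp [pd, fderiv_fun_sum (fun i _ => hf i x)]

lemma pd_const (j : Fin 3) (c : ℝ) (x : E3) : pd j (fun _ => c) x = 0 := by
  simp [pd]

lemma pd_const_mul (j : Fin 3) (c : ℝ) {f : E3 → ℝ} (hf : Differentiable ℝ f) (x : E3) :
    pd j (fun y => c * f y) x = c * pd j f x := by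
  rw [pd_mul j (differentiable_const c) hf, pd_const]
  ring

lemma pd_sq (j : Fin 3) {f : E3 → ℝ} (hf : Differentiable ℝ f) (x : E3) :
    pd j (fun y => f y ^ 2) x = 2 * (f x * pd j f x) := by
  simp only [sq]
  rw [pd_mul j hf hf]
  ring

lemma contDiff_pd (j : Fin 3) {f : E3 → ℝ} (hf : ContDiff ℝ (⊤ : ℕ∞) f) :
    ContDiff ℝ (⊤ : ℕ∞) (pd j f) :=
  (hf.fderiv_right (m := (⊤ : ℕ∞)) (by simp)).clm_apply contDiff_const

lemma smooth_differentiable {f : E3 → ℝ} (hf : ContDiff ℝ (⊤ : ℕ∞) f) : Differentiable ℝ f :=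
  hf.differentiable (by simp)

lemma pd_comm (i j : Fin 3) {f : E3 → ℝ} (hf : ContDiff ℝ (⊤ : ℕ∞) f) (x : E3) :
    pd i (pd j f) x = pd j (pd i f) x := by
  have hd : Differentiable ℝ (fderiv ℝ f) :=
    (hf.fderiv_right (m := (⊤ : ℕ∞)) (by simp)).differentiable (by simp)
  have key : ∀ a b : Fin 3, pd a (pd b f) x =
      fderiv ℝ (fderiv ℝ f) x (EuclideanSpace.single a 1) (EuclideanSpace.single b 1) := by
    intro a b
    unfold pd
    rw [fderiv_clm_apply (hd x) (differentiableAt_const _)]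
    simp
  rw [key, key]
  exact (hf.contDiffAt.isSymmSndFDerivAt (by
    rw [minSmoothness_of_isRCLikeNormedField]; exact WithTop.coe_le_coe.2 le_top)) _ _

lemma pd_comp_smul (j : Fin 3) (f : E3 → ℝ) (c : ℝ) (x : E3) :
    pd j (fun y => f (c • y)) x = c * pd j f (c • x) := by
  unfold pd
  rw [fderiv_comp_smul]
  simp

lemma lap_comp_smul {f : E3 → ℝ} (hf : ContDiff ℝ (⊤ : ℕ∞) f) (c : ℝ) (x : E3) :
    lap (fun y => f (c • y)) x = c ^ 2 * lap f (c • x) := by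
  unfold lap
  rw [Finset.mul_sum]
  refine Finset.sum_congr rfl fun j _ => ?_
  have h : pd j (fun y => f (c • y)) = fun y => c * (fun z => pd j f (c • z)) y :=
    funext fun y => pd_comp_smul j f c y
  rw [h, pd_const_mul j c, pd_comp_smul]
  · ring
  · exact (smooth_differentiable (contDiff_pd j hf)).comp (differentiable_id.const_smul c)

lemma integral_pd_eq_zero (j : Fin 3) {f : E3 → ℝ} (hf : ContDiff ℝ (⊤ : ℕ∞) f)
    (hc : HasCompactSupport f) : ∫ x, pd j f x = 0 := by
  have hi : Integrable f := hf.continuous.integrable_of_hasCompactSupport hc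
  have hc' : HasCompactSupport (pd j f) := hc.fderiv_apply ℝ _
  have hi' : Integrable (pd j f) :=
    (contDiff_pd j hf).continuous.integrable_of_hasCompactSupport hc'
  have := integral_mul_fderiv_eq_neg_fderiv_mul_of_integrable (𝕜 := ℝ) (μ := (volume : Measure E3))
    (f := fun _ => (1 : ℝ)) (g := f) (v := EuclideanSpace.single j 1)
    (by simp) (by simp only [one_mul]; exact hi') (by simpa using hi)
    (fun _ _ => differentiableAt_const _) (fun x _ => smooth_differentiable hf x)
  simpa [pd] using this

/-- The kinetic energy density `|u|² / 2`. -/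
def kinetic (u : E3 → Fin 3 → ℝ) (x : E3) : ℝ := 1 / 2 * ∑ i, u x i ^ 2

/-- The total head `|u|² / 2 + |∇v|² / 2 + P`. -/
def head (u : E3 → Fin 3 → ℝ) (P : E3 → ℝ) (v : E3 → Fin 3 → ℝ) (x : E3) : ℝ :=
  kinetic u x + 1 / 2 * gradSq v x + P x

section Calculus

variable {u v : E3 → Fin 3 → ℝ} {P φ : E3 → ℝ}

lemma contDiff_comp_apply (hu : ContDiff ℝ (⊤ : ℕ∞) u) (i : Fin 3) :
    ContDiff ℝ (⊤ : ℕ∞) (fun y => u y i) :=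
  contDiff_pi.1 hu i

lemma contDiff_kinetic (hu : ContDiff ℝ (⊤ : ℕ∞) u) : ContDiff ℝ (⊤ : ℕ∞) (kinetic u) :=
  contDiff_const.mul (ContDiff.sum fun i _ => (contDiff_comp_apply hu i).pow 2)

lemma contDiff_gradSq (hv : ContDiff ℝ (⊤ : ℕ∞) v) : ContDiff ℝ (⊤ : ℕ∞) (gradSq v) :=
  ContDiff.sum fun i _ => ContDiff.sum fun k _ =>
    (contDiff_pd i (contDiff_comp_apply hv k)).pow 2

lemma contDiff_head (hu : ContDiff ℝ (⊤ : ℕ∞) u) (hP : ContDiff ℝ (⊤ : ℕ∞) P)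
    (hv : ContDiff ℝ (⊤ : ℕ∞) v) : ContDiff ℝ (⊤ : ℕ∞) (head u P v) :=
  ((contDiff_kinetic hu).add (contDiff_const.mul (contDiff_gradSq hv))).add hP

lemma pd_kinetic (hu : ContDiff ℝ (⊤ : ℕ∞) u) (j : Fin 3) (x : E3) :
    pd j (kinetic u) x = ∑ i, u x i * pd j (fun y => u y i) x := by
  have hd := fun i => smooth_differentiable (contDiff_comp_apply hu i)
  unfold kinetic
  rw [pd_const_mul j _ (Differentiable.fun_sum fun i _ => (hd i).fun_pow 2),
    pd_sum j _ fun i => (hd i).fun_pow 2, Finset.mul_sum]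
  refine Finset.sum_congr rfl fun i _ => ?_
  rw [pd_sq j (hd i)]
  ring

lemma lap_kinetic (hu : ContDiff ℝ (⊤ : ℕ∞) u) (x : E3) :
    lap (kinetic u) x = gradSq u x + ∑ i, u x i * lap (fun y => u y i) x := by
  have hs := contDiff_comp_apply hu
  have hd := fun i => smooth_differentiable (hs i)
  have hd' := fun j i => smooth_differentiable (contDiff_pd j (hs i))
  simp only [lap, gradSq, Finset.mul_sum]
  rw [Finset.sum_comm (s := Finset.univ) (t := Finset.univ)
    (f := fun i j => u x i * pd j (pd j fun y => u y i) x), ← Finset.sum_add_distrib]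
  refine Finset.sum_congr rfl fun j _ => ?_
  rw [funext (pd_kinetic hu j), pd_sum j _ fun i => (hd i).fun_mul (hd' j i),
    ← Finset.sum_add_distrib]
  refine Finset.sum_congr rfl fun i _ => ?_
  rw [pd_mul j (hd i) (hd' j i)]
  ring

lemma pd_gradSq (hv : ContDiff ℝ (⊤ : ℕ∞) v) (j : Fin 3) (x : E3) :
    pd j (gradSq v) x =
      2 * ∑ i, ∑ k, pd i (fun y => v y k) x * pd j (pd i fun y => v y k) x := by
  have hd := fun i k => smooth_differentiable (contDiff_pd i (contDiff_comp_apply hv k))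
  unfold gradSq
  simp only [Finset.mul_sum]
  rw [pd_sum j _ fun i => Differentiable.fun_sum fun k _ => (hd i k).fun_pow 2]
  refine Finset.sum_congr rfl fun i _ => ?_
  rw [pd_sum j _ fun k => (hd i k).fun_pow 2]
  exact Finset.sum_congr rfl fun k _ => pd_sq j (hd i k) x

/-- `div (∇v ⊙ ∇v) = ∇|∇v|² / 2 + Δv · ∇v`. -/
lemma div_gradient_tensor (hv : ContDiff ℝ (⊤ : ℕ∞) v) (i : Fin 3) (x : E3) :
    ∑ j, ∑ k, pd j (fun y => pd i (fun z => v z k) y * pd j (fun z => v z k) y) x =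
      1 / 2 * pd i (gradSq v) x +
        ∑ k, pd i (fun y => v y k) x * lap (fun y => v y k) x := by
  have hs := contDiff_comp_apply hv
  have hd := fun i k => smooth_differentiable (contDiff_pd i (hs k))
  rw [pd_gradSq hv]
  simp only [lap, Finset.mul_sum]
  rw [Finset.sum_comm (s := Finset.univ) (t := Finset.univ)
    (f := fun k j => pd i (fun y => v y k) x * pd j (pd j fun y => v y k) x),
    ← Finset.sum_add_distrib]
  refine Finset.sum_congr rfl fun j _ => ?_
  rw [← Finset.sum_add_distrib]
  refine Finset.sum_congr rfl fun k _ => ?_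
  rw [pd_mul j (hd i k) (hd j k), pd_comm j i (hs k)]
  ring

lemma sum_mul_pd_eq_zero_of_unit (hv : ContDiff ℝ (⊤ : ℕ∞) v)
    (hunit : ∀ x : E3, ∑ i, (v x i) ^ 2 = 1) (j : Fin 3) (x : E3) :
    ∑ k, v x k * pd j (fun y => v y k) x = 0 := by
  rw [← pd_kinetic hv]
  have : kinetic v = fun _ => 1 / 2 := by
    funext y
    simp [kinetic, hunit]
  rw [this, pd_const]

lemma advection_head (hu : ContDiff ℝ (⊤ : ℕ∞) u) (hP : ContDiff ℝ (⊤ : ℕ∞) P)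
    (hv : ContDiff ℝ (⊤ : ℕ∞) v) (hunit : ∀ x : E3, ∑ i, (v x i) ^ 2 = 1)
    (hsol : StatEL u P v) (x : E3) :
    ∑ i, u x i * lap (fun y => u y i) x =
      ∑ j, u x j * pd j (head u P v) x +
        ∑ k, (∑ j, u x j * pd j (fun y => v y k) x) ^ 2 := by
  obtain ⟨hmom, hdir, -⟩ := hsol
  have hhead : ∀ j, pd j (head u P v) x =
      ∑ i, u x i * pd j (fun y => u y i) x + 1 / 2 * pd j (gradSq v) x + pd j P x := by
    intro j
    have h1 := smooth_differentiable (contDiff_kinetic hu)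
    have h2 := smooth_differentiable (contDiff_gradSq hv)
    unfold head
    rw [pd_add j (h1.fun_add (h2.const_mul _)) (smooth_differentiable hP),
      pd_add j h1 (h2.const_mul _), pd_const_mul j _ h2, pd_kinetic hu]
  have h0 := fun j => sum_mul_pd_eq_zero_of_unit hv hunit j x
  have hm := hmom x
  have hd := hdir x
  simp only [div_gradient_tensor hv] at hm
  simp only [hhead]
  simp only [Fin.sum_univ_three] at *
  generalize gradSq v x = G at *
  have d0 := hd 0
  have d1 := hd 1
  have d2 := hd 2
  have m0 := hm 0
  have m1 := hm 1
  have m2 := hm 2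
  have e0 : lap (fun y => v y 0) x = u x 0 * pd 0 (fun y => v y 0) x +
    u x 1 * pd 1 (fun y => v y 0) x + u x 2 * pd 2 (fun y => v y 0) x - G * v x 0 := by linarith
  have e1 : lap (fun y => v y 1) x = u x 0 * pd 0 (fun y => v y 1) x +
    u x 1 * pd 1 (fun y => v y 1) x + u x 2 * pd 2 (fun y => v y 1) x - G * v x 1 := by linarith
  have e2 : lap (fun y => v y 2) x = u x 0 * pd 0 (fun y => v y 2) x +
    u x 1 * pd 1 (fun y => v y 2) x + u x 2 * pd 2 (fun y => v y 2) x - G * v x 2 := by linarith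
  rw [e0, e1, e2] at m0 m1 m2
  linear_combination (-u x 0) * m0 - u x 1 * m1 - u x 2 * m2
    - G * u x 0 * h0 0 - G * u x 1 * h0 1 - G * u x 2 * h0 2

/-- The compactly supported vector field whose divergence gives the localized energy identity. -/
def energyFlux (φ : E3 → ℝ) (u : E3 → Fin 3 → ℝ) (P : E3 → ℝ) (v : E3 → Fin 3 → ℝ)
    (j : Fin 3) (y : E3) : ℝ :=
  φ y * (pd j (kinetic u) y - head u P v y * u y j) - kinetic u y * pd j φ y

lemma div_energyFlux (hφ : ContDiff ℝ (⊤ : ℕ∞) φ) (hu : ContDiff ℝ (⊤ : ℕ∞) u)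
    (hP : ContDiff ℝ (⊤ : ℕ∞) P) (hv : ContDiff ℝ (⊤ : ℕ∞) v)
    (hunit : ∀ x : E3, ∑ i, (v x i) ^ 2 = 1) (hsol : StatEL u P v) (x : E3) :
    ∑ j, pd j (energyFlux φ u P v j) x =
      φ x * (gradSq u x + ∑ k, (∑ j, u x j * pd j (fun y => v y k) x) ^ 2) -
        (kinetic u x * lap φ x + head u P v x * ∑ j, u x j * pd j φ x) := by
  have hK := contDiff_kinetic hu
  have hH := contDiff_head hu hP hv
  have hadv := advection_head hu hP hv hunit hsol x
  have hlap := lap_kinetic hu x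
  have hdiv := hsol.2.2 x
  have hterm : ∀ j, pd j (energyFlux φ u P v j) x =
      pd j φ x * (pd j (kinetic u) x - head u P v x * u x j) +
        φ x * (pd j (pd j (kinetic u)) x - (pd j (head u P v) x * u x j +
          head u P v x * pd j (fun y => u y j) x)) -
        (pd j (kinetic u) x * pd j φ x + kinetic u x * pd j (pd j φ) x) := by
    intro j
    have d1 := smooth_differentiable hφ
    have d2 := smooth_differentiable (contDiff_pd j hK)
    have d3 := smooth_differentiable hH
    have d4 := smooth_differentiable (contDiff_comp_apply hu j)
    have d5 := smooth_differentiable hK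
    have d6 := smooth_differentiable (contDiff_pd j hφ)
    unfold energyFlux
    rw [pd_sub j (d1.fun_mul (d2.fun_sub (d3.fun_mul d4))) (d5.fun_mul d6), pd_mul j d1 (d2.fun_sub (d3.fun_mul d4)),
      pd_sub j d2 (d3.fun_mul d4), pd_mul j d3 d4, pd_mul j d5 d6]
  simp only [hterm]
  generalize head u P v x = H at *
  generalize (∑ k, (∑ j, u x j * pd j (fun y => v y k) x) ^ 2) = A at *
  generalize (∑ i, u x i * lap (fun y => u y i) x) = L at *
  simp only [lap] at hlap ⊢
  simp only [Fin.sum_univ_three] at *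
  linear_combination φ x * hlap + φ x * hadv - φ x * H * hdiv

lemma contDiff_energyFlux (hφ : ContDiff ℝ (⊤ : ℕ∞) φ) (hu : ContDiff ℝ (⊤ : ℕ∞) u)
    (hP : ContDiff ℝ (⊤ : ℕ∞) P) (hv : ContDiff ℝ (⊤ : ℕ∞) v) (j : Fin 3) :
    ContDiff ℝ (⊤ : ℕ∞) (energyFlux φ u P v j) :=
  (hφ.mul ((contDiff_pd j (contDiff_kinetic hu)).sub
    ((contDiff_head hu hP hv).mul (contDiff_comp_apply hu j)))).sub
    ((contDiff_kinetic hu).mul (contDiff_pd j hφ))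

lemma hasCompactSupport_pd (j : Fin 3) (hc : HasCompactSupport φ) :
    HasCompactSupport (pd j φ) :=
  hc.fderiv_apply ℝ _

lemma hasCompactSupport_energyFlux (hc : HasCompactSupport φ) (j : Fin 3) :
    HasCompactSupport (energyFlux φ u P v j) := by
  have h1 : HasCompactSupport
      (φ * fun y => pd j (kinetic u) y - head u P v y * u y j) := hc.mul_right
  have h2 : HasCompactSupport (kinetic u * pd j φ) := (hasCompactSupport_pd j hc).mul_left
  exact h1.sub h2

/-- Localized energy inequality. -/
lemma integral_cutoff_mul_gradSq_le (hφ : ContDiff ℝ (⊤ : ℕ∞) φ) (hc : HasCompactSupport φ)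
    (hφ0 : ∀ x, 0 ≤ φ x) (hu : ContDiff ℝ (⊤ : ℕ∞) u)
    (hP : ContDiff ℝ (⊤ : ℕ∞) P) (hv : ContDiff ℝ (⊤ : ℕ∞) v)
    (hunit : ∀ x : E3, ∑ i, (v x i) ^ 2 = 1) (hsol : StatEL u P v) :
    ∫ x, φ x * gradSq u x ≤
      ∫ x, (kinetic u x * lap φ x + head u P v x * ∑ j, u x j * pd j φ x) := by
  have hpd := fun (j : Fin 3) {f : E3 → ℝ} (hf : ContDiff ℝ (⊤ : ℕ∞) f) =>
    (contDiff_pd j hf).continuous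
  have hint : Integrable fun x => ∑ j, pd j (energyFlux φ u P v j) x :=
    integrable_finsetSum _ fun j _ =>
      (hpd j (contDiff_energyFlux hφ hu hP hv j)).integrable_of_hasCompactSupport
        (hasCompactSupport_pd j (hasCompactSupport_energyFlux hc j))
  have hzero : ∫ x, ∑ j, pd j (energyFlux φ u P v j) x = 0 := by
    rw [integral_finsetSum]
    · exact Finset.sum_eq_zero fun j _ => integral_pd_eq_zero j
        (contDiff_energyFlux hφ hu hP hv j) (hasCompactSupport_energyFlux hc j)
    · exact fun j _ => (hpd j (contDiff_energyFlux hφ hu hP hv j)).integrable_of_hasCompactSupport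
        (hasCompactSupport_pd j (hasCompactSupport_energyFlux hc j))
  have hint1 : Integrable fun x => φ x * gradSq u x :=
    (hφ.continuous.mul (contDiff_gradSq hu).continuous).integrable_of_hasCompactSupport
      hc.mul_right
  have hint2 : Integrable fun x => φ x * (gradSq u x +
      ∑ k, (∑ j, u x j * pd j (fun y => v y k) x) ^ 2) := by
    refine Continuous.integrable_of_hasCompactSupport ?_ hc.mul_right
    refine hφ.continuous.mul ((contDiff_gradSq hu).continuous.add ?_)
    exact continuous_finsetSum _ fun k _ => (continuous_finsetSum _ fun j _ =>
      (contDiff_comp_apply hu j).continuous.mul (hpd j (contDiff_comp_apply hv k))).pow 2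
  have heq := fun x => div_energyFlux hφ hu hP hv hunit hsol x
  calc ∫ x, φ x * gradSq u x
      ≤ ∫ x, φ x * (gradSq u x + ∑ k, (∑ j, u x j * pd j (fun y => v y k) x) ^ 2) := by
        refine integral_mono hint1 hint2 fun x => ?_
        exact mul_le_mul_of_nonneg_left
          (le_add_of_nonneg_right (Finset.sum_nonneg fun k _ => sq_nonneg _)) (hφ0 x)
    _ = ∫ x, (φ x * (gradSq u x + ∑ k, (∑ j, u x j * pd j (fun y => v y k) x) ^ 2) -
          ∑ j, pd j (energyFlux φ u P v j) x) := by
        rw [integral_sub hint2 hint, hzero, sub_zero]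
    _ = _ := by
        refine integral_congr_ae (ae_of_all _ fun x => ?_)
        simp only [heq]
        ring

end Calculus

section Holder

variable {α : Type*} [MeasurableSpace α] {μ : Measure α}

lemma ofReal_integral_rpow {f : α → ℝ} (hf : Integrable f μ) (hf0 : ∀ x, 0 ≤ f x) {w : ℝ}
    (hw : 0 ≤ w) : (∫⁻ x, ENNReal.ofReal (f x) ∂μ) ^ w = ENNReal.ofReal ((∫ x, f x ∂μ) ^ w) := by
  rw [← ofReal_integral_eq_lintegral_ofReal hf (ae_of_all _ hf0),
    ENNReal.ofReal_rpow_of_nonneg (integral_nonneg hf0) hw]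

/-- Hölder's inequality with exponents `p / 2`, `p` and `p / (p - 3)` for `f · g · 1`. -/
lemma integral_mul_le_rpow_mul_rpow_mul_measure [IsFiniteMeasure μ] {f g : α → ℝ} {p : ℝ} (hp : 3 ≤ p)
    (hf0 : ∀ x, 0 ≤ f x) (hg0 : ∀ x, 0 ≤ g x)
    (hfg : Integrable (fun x => f x * g x) μ)
    (hf : Integrable (fun x => f x ^ (p / 2)) μ) (hg : Integrable (fun x => g x ^ p) μ) :
    ∫ x, f x * g x ∂μ ≤
      (∫ x, f x ^ (p / 2) ∂μ) ^ (2 / p) * (∫ x, g x ^ p ∂μ) ^ (1 / p) *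
        μ.real Set.univ ^ (1 - 3 / p) := by
  have hp0 : 0 < p := by linarith
  have hf0' : ∀ x, 0 ≤ f x ^ (p / 2) := fun x => rpow_nonneg (hf0 x) _
  have hg0' : ∀ x, 0 ≤ g x ^ p := fun x => rpow_nonneg (hg0 x) _
  have hw1 : 0 ≤ 2 / p := by positivity
  have hw2 : 0 ≤ 1 / p := by positivity
  have hw3 : 0 ≤ 1 - 3 / p := sub_nonneg.2 ((div_le_one hp0).2 hp)
  have key := ENNReal.lintegral_prod_norm_pow_le (μ := μ) (Finset.univ : Finset (Fin 3))
    (f := ![fun x => ENNReal.ofReal (f x ^ (p / 2)), fun x => ENNReal.ofReal (g x ^ p),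
      fun _ => ENNReal.ofReal 1]) (p := ![2 / p, 1 / p, 1 - 3 / p])
    (by
      intro i _
      fin_cases i
      · exact hf.aestronglyMeasurable.aemeasurable.ennreal_ofReal
      · exact hg.aestronglyMeasurable.aemeasurable.ennreal_ofReal
      · exact aemeasurable_const)
    (by simp [Fin.sum_univ_three]; ring)
    (by
      intro i _
      fin_cases i
      exacts [hw1, hw2, hw3])
  simp only [Fin.prod_univ_three, Matrix.cons_val_zero, Matrix.cons_val_one,
    Matrix.cons_val_two, Matrix.head_cons, Matrix.tail_cons] at key
  rw [ofReal_integral_rpow hf hf0' hw1, ofReal_integral_rpow hg hg0' hw2,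
    ofReal_integral_rpow (integrable_const 1) (fun _ => zero_le_one) hw3] at key
  have hI1 : 0 ≤ (∫ x, f x ^ (p / 2) ∂μ) ^ (2 / p) := rpow_nonneg (integral_nonneg hf0') _
  have hI2 : 0 ≤ (∫ x, g x ^ p ∂μ) ^ (1 / p) := rpow_nonneg (integral_nonneg hg0') _
  have hleft : ∀ x, ENNReal.ofReal (f x ^ (p / 2)) ^ (2 / p) * ENNReal.ofReal (g x ^ p) ^ (1 / p) *
      ENNReal.ofReal 1 ^ (1 - 3 / p) = ENNReal.ofReal (f x * g x) := by
    intro x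
    rw [ENNReal.ofReal_rpow_of_nonneg (hf0' x) hw1, ENNReal.ofReal_rpow_of_nonneg (hg0' x) hw2,
      ← rpow_mul (hf0 x), ← rpow_mul (hg0 x), ENNReal.ofReal_mul (hf0 x),
      show p / 2 * (2 / p) = 1 by field_simp, show p * (1 / p) = 1 by field_simp]
    simp
  simp only [hleft] at key
  rw [← ofReal_integral_eq_lintegral_ofReal hfg
    (ae_of_all _ fun x => mul_nonneg (hf0 x) (hg0 x)), ← ENNReal.ofReal_mul hI1,
    ← ENNReal.ofReal_mul (mul_nonneg hI1 hI2)] at key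
  have hconst : ∫ _, (1 : ℝ) ∂μ = μ.real Set.univ := by simp
  rw [hconst] at key
  exact (ENNReal.ofReal_le_ofReal_iff (by positivity)).1 key

end Holder

lemma pd_eq_zero_of_eventuallyEq_const {f : E3 → ℝ} {x : E3} {c : ℝ}
    (h : f =ᶠ[nhds x] fun _ => c) (j : Fin 3) : pd j f x = 0 := by
  simp [pd, h.fderiv_eq]

lemma lap_eq_zero_of_eventuallyEq_const {f : E3 → ℝ} {x : E3} {c : ℝ}
    (h : f =ᶠ[nhds x] fun _ => c) : lap f x = 0 := by
  refine Finset.sum_eq_zero fun j _ => pd_eq_zero_of_eventuallyEq_const (c := 0) ?_ j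
  filter_upwards [h.eventually_nhds] with y hy
  exact pd_eq_zero_of_eventuallyEq_const hy j

/-- Smooth cutoffs between `B_{R/2}` and `B_R` with derivative bounds scaling in `R`. -/
lemma exists_cutoff : ∃ M : ℝ, 0 < M ∧ ∀ R : ℝ, 0 < R → ∃ φ : E3 → ℝ,
    ContDiff ℝ (⊤ : ℕ∞) φ ∧ HasCompactSupport φ ∧ (∀ x, 0 ≤ φ x) ∧
    (∀ x ∈ ball (0 : E3) (R / 2), φ x = 1) ∧
    (∀ x ∉ ann R, (∀ j, pd j φ x = 0) ∧ lap φ x = 0) ∧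
    (∀ x j, |pd j φ x| ≤ M / R) ∧ ∀ x, |lap φ x| ≤ M / R ^ 2 := by
  let η : ContDiffBump (0 : E3) := ⟨5 / 8, 7 / 8, by norm_num, by norm_num⟩
  have hη : ContDiff ℝ (⊤ : ℕ∞) η := η.contDiff
  have hηc : HasCompactSupport η := η.hasCompactSupport
  have hpdc := fun j => hasCompactSupport_pd (φ := η) j hηc
  choose C hC using fun j =>
    (hpdc j).exists_bound_of_continuous (contDiff_pd j hη).continuous
  choose D hD using fun j => (hasCompactSupport_pd j (hpdc j)).exists_bound_of_continuous
    (contDiff_pd j (contDiff_pd j hη)).continuous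
  have hC0 : ∀ j, 0 ≤ C j := fun j => (norm_nonneg _).trans (hC j 0)
  have hD0 : ∀ j, 0 ≤ D j := fun j => (norm_nonneg _).trans (hD j 0)
  have hCs : 0 ≤ ∑ j, C j := Finset.sum_nonneg fun j _ => hC0 j
  have hDs : 0 ≤ ∑ j, D j := Finset.sum_nonneg fun j _ => hD0 j
  refine ⟨∑ j, C j + ∑ j, D j + 1, by positivity, fun R hR => ?_⟩
  have hnorm : ∀ x : E3, ‖R⁻¹ • x‖ = ‖x‖ / R := by
    intro x
    rw [norm_smul, norm_inv, Real.norm_of_nonneg hR.le, inv_mul_eq_div]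
  have hcont : Continuous fun x : E3 => R⁻¹ • x := continuous_const_smul _
  refine ⟨fun x => η (R⁻¹ • x), hη.comp (contDiff_const_smul _),
    hηc.comp_homeomorph (Homeomorph.smulOfNeZero R⁻¹ (inv_ne_zero hR.ne')),
    fun x => η.nonneg, ?_, ?_, ?_, ?_⟩
  · intro x hx
    rw [mem_ball_zero_iff] at hx
    refine η.one_of_mem_closedBall ?_
    rw [mem_closedBall_zero_iff, hnorm, div_le_iff₀ hR]
    change ‖x‖ ≤ 5 / 8 * R
    linarith
  · intro x hx
    have hev : ∃ c : ℝ, (fun x => η (R⁻¹ • x)) =ᶠ[nhds x] fun _ => c := by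
      by_cases h : R / 2 < ‖x‖
      · have h' : R ≤ ‖x‖ := not_lt.1 fun h' => hx ⟨h, h'⟩
        refine ⟨0, ?_⟩
        have : {y : E3 | 7 / 8 * R < ‖y‖} ∈ nhds x :=
          (isOpen_lt continuous_const continuous_norm).mem_nhds
            (show 7 / 8 * R < ‖x‖ by linarith)
        filter_upwards [this] with y hy
        refine η.zero_of_le_dist ?_
        rw [dist_zero_right, hnorm, le_div_iff₀ hR]
        exact le_of_lt hy
      · refine ⟨1, ?_⟩
        have : {y : E3 | ‖y‖ < 5 / 8 * R} ∈ nhds x :=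
          (isOpen_lt continuous_norm continuous_const).mem_nhds
            (show ‖x‖ < 5 / 8 * R by linarith)
        filter_upwards [this] with y hy
        refine η.one_of_mem_closedBall ?_
        rw [mem_closedBall_zero_iff, hnorm, div_le_iff₀ hR]
        exact le_of_lt hy
    obtain ⟨c, hc⟩ := hev
    exact ⟨pd_eq_zero_of_eventuallyEq_const hc, lap_eq_zero_of_eventuallyEq_const hc⟩
  · intro x j
    rw [pd_comp_smul, abs_mul, abs_inv, abs_of_pos hR, inv_mul_eq_div]
    gcongr
    have h1 : C j ≤ ∑ j, C j :=
      Finset.single_le_sum (fun j _ => hC0 j) (Finset.mem_univ j)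
    have h2 := hC j (R⁻¹ • x)
    rw [Real.norm_eq_abs] at h2
    linarith
  · intro x
    rw [lap_comp_smul hη, abs_mul, abs_pow, abs_inv, abs_of_pos hR, inv_pow, inv_mul_eq_div]
    gcongr
    have h : |lap η (R⁻¹ • x)| ≤ ∑ j, D j :=
      (Finset.abs_sum_le_sum_abs _ _).trans (Finset.sum_le_sum fun j _ => hD j _)
    linarith

lemma ann_subset_ball (R : ℝ) : ann R ⊆ ball 0 R := fun _ hx => mem_ball_zero_iff.2 hx.2

lemma measurableSet_ann (R : ℝ) : MeasurableSet (ann R) :=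
  (isOpen_lt continuous_const continuous_norm).measurableSet.inter
    (isOpen_lt continuous_norm continuous_const).measurableSet

lemma isFiniteMeasure_restrict_ann (R : ℝ) :
    IsFiniteMeasure ((volume : Measure E3).restrict (ann R)) :=
  ⟨by
    rw [Measure.restrict_apply_univ]
    exact (measure_mono (ann_subset_ball R)).trans_lt measure_ball_lt_top⟩

lemma integrableOn_ann {f : E3 → ℝ} (hf : Continuous f) (R : ℝ) : IntegrableOn f (ann R) :=
  (hf.continuousOn.integrableOn_compact (isCompact_closedBall 0 R)).mono_set
    ((ann_subset_ball R).trans ball_subset_closedBall)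

lemma volume_real_ann_le {R : ℝ} (hR : 0 < R) :
    (volume : Measure E3).real (ann R) ≤ R ^ 3 * (volume : Measure E3).real (ball 0 1) := by
  refine (measureReal_mono (ann_subset_ball R) measure_ball_lt_top.ne).trans_eq ?_
  rw [measureReal_def, measureReal_def, Measure.addHaar_ball _ _ hR.le, ENNReal.toReal_mul,
    ENNReal.toReal_ofReal (by positivity), finrank_euclideanSpace_fin]

lemma integral_ann_mul_le {f g : E3 → ℝ} {p R : ℝ} (hp : 3 ≤ p) (hR : 0 < R)
    (hf : Continuous f) (hg : Continuous g) (hf0 : ∀ x, 0 ≤ f x) (hg0 : ∀ x, 0 ≤ g x) :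
    R⁻¹ * ∫ x in ann R, f x * g x ≤ (volume : Measure E3).real (ball 0 1) ^ (1 - 3 / p) *
      ((∫ x in ann R, f x ^ (p / 2)) ^ (2 / p) * R ^ (2 - 9 / p) *
        (∫ x in ann R, g x ^ p) ^ (1 / p)) := by
  have hp0 : 0 < p := by linarith
  have hw : 0 ≤ 1 - 3 / p := sub_nonneg.2 ((div_le_one hp0).2 hp)
  have := isFiniteMeasure_restrict_ann R
  have hholder := integral_mul_le_rpow_mul_rpow_mul_measure
    (μ := (volume : Measure E3).restrict (ann R)) hp hf0 hg0
    (integrableOn_ann (hf.mul hg) R)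
    (integrableOn_ann (hf.rpow_const fun x => Or.inr (by positivity)) R)
    (integrableOn_ann (hg.rpow_const fun x => Or.inr hp0.le) R)
  have hI1 : 0 ≤ (∫ x in ann R, f x ^ (p / 2)) ^ (2 / p) :=
    rpow_nonneg (integral_nonneg fun x => rpow_nonneg (hf0 x) _) _
  have hI2 : 0 ≤ (∫ x in ann R, g x ^ p) ^ (1 / p) :=
    rpow_nonneg (integral_nonneg fun x => rpow_nonneg (hg0 x) _) _
  have hvol : R⁻¹ * ((volume : Measure E3).restrict (ann R)).real Set.univ ^ (1 - 3 / p) ≤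
      R ^ (2 - 9 / p) * (volume : Measure E3).real (ball 0 1) ^ (1 - 3 / p) := by
    rw [measureReal_restrict_apply_univ]
    calc R⁻¹ * (volume : Measure E3).real (ann R) ^ (1 - 3 / p)
        ≤ R⁻¹ * (R ^ 3 * (volume : Measure E3).real (ball 0 1)) ^ (1 - 3 / p) := by
          gcongr
          exact volume_real_ann_le hR
      _ = _ := by
          rw [mul_rpow (by positivity) measureReal_nonneg, ← mul_assoc, ← rpow_natCast R 3,
            ← rpow_mul hR.le, ← rpow_neg_one R, ← rpow_add hR]
          congr 2
          push_cast
          ring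
  calc R⁻¹ * ∫ x in ann R, f x * g x
      ≤ R⁻¹ * ((∫ x in ann R, f x ^ (p / 2)) ^ (2 / p) * (∫ x in ann R, g x ^ p) ^ (1 / p) *
          ((volume : Measure E3).restrict (ann R)).real Set.univ ^ (1 - 3 / p)) := by gcongr
    _ = (∫ x in ann R, f x ^ (p / 2)) ^ (2 / p) * (∫ x in ann R, g x ^ p) ^ (1 / p) *
          (R⁻¹ * ((volume : Measure E3).restrict (ann R)).real Set.univ ^ (1 - 3 / p)) := by ring
    _ ≤ (∫ x in ann R, f x ^ (p / 2)) ^ (2 / p) * (∫ x in ann R, g x ^ p) ^ (1 / p) *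
          (R ^ (2 - 9 / p) * (volume : Measure E3).real (ball 0 1) ^ (1 - 3 / p)) := by gcongr
    _ = _ := by ring

lemma gradSq_nonneg (v : E3 → Fin 3 → ℝ) (x : E3) : 0 ≤ gradSq v x :=
  Finset.sum_nonneg fun _ _ => Finset.sum_nonneg fun _ _ => sq_nonneg _

lemma vecNorm_nonneg (u : E3 → Fin 3 → ℝ) (x : E3) : 0 ≤ vecNorm u x := Real.sqrt_nonneg _

lemma vecNorm_sq (u : E3 → Fin 3 → ℝ) (x : E3) : vecNorm u x ^ 2 = ∑ i, u x i ^ 2 :=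
  Real.sq_sqrt (Finset.sum_nonneg fun _ _ => sq_nonneg _)

lemma abs_apply_le_vecNorm (u : E3 → Fin 3 → ℝ) (x : E3) (i : Fin 3) :
    |u x i| ≤ vecNorm u x :=
  Real.abs_le_sqrt (Finset.single_le_sum (f := fun i => u x i ^ 2)
    (fun _ _ => sq_nonneg _) (Finset.mem_univ i))

lemma energy_integrand_le {u v : E3 → Fin 3 → ℝ} {P φ : E3 → ℝ} {M R : ℝ} {x : E3}
    (h1 : ∀ j, |pd j φ x| ≤ M / R) (h2 : |lap φ x| ≤ M / R ^ 2) :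
    kinetic u x * lap φ x + head u P v x * ∑ j, u x j * pd j φ x ≤
      M / (2 * R ^ 2) * ∑ i, u x i ^ 2 +
        (3 * M / 2 * (R⁻¹ * (vecNorm u x ^ 2 * vecNorm u x)) +
        3 * M / 2 * (R⁻¹ * (gradSq v x * vecNorm u x)) +
        3 * M * (R⁻¹ * (|P x| * vecNorm u x))) := by
  have hg := gradSq_nonneg v x
  have hn := vecNorm_nonneg u x
  have hK : kinetic u x = 1 / 2 * vecNorm u x ^ 2 := by rw [vecNorm_sq]; rfl
  have hK0 : 0 ≤ kinetic u x := by rw [hK]; positivity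
  have hflux : |∑ j, u x j * pd j φ x| ≤ 3 * (vecNorm u x * (M / R)) := by
    calc |∑ j, u x j * pd j φ x| ≤ ∑ j, |u x j * pd j φ x| := Finset.abs_sum_le_sum_abs _ _
      _ ≤ ∑ _j : Fin 3, vecNorm u x * (M / R) := Finset.sum_le_sum fun j _ => by
          rw [abs_mul]
          exact mul_le_mul (abs_apply_le_vecNorm u x j) (h1 j) (abs_nonneg _) hn
      _ = _ := by simp
  have hH : |head u P v x| ≤ 1 / 2 * vecNorm u x ^ 2 + 1 / 2 * gradSq v x + |P x| := by
    rw [head, hK]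
    refine (abs_add_le _ _).trans (add_le_add_left (abs_of_nonneg ?_).le _)
    positivity
  have e1 : kinetic u x * lap φ x ≤ kinetic u x * (M / R ^ 2) :=
    mul_le_mul_of_nonneg_left ((le_abs_self _).trans h2) hK0
  have e2 : head u P v x * ∑ j, u x j * pd j φ x ≤
      (1 / 2 * vecNorm u x ^ 2 + 1 / 2 * gradSq v x + |P x|) * (3 * (vecNorm u x * (M / R))) := by
    refine (le_abs_self _).trans ?_
    rw [abs_mul]
    exact mul_le_mul hH hflux (abs_nonneg _) (by positivity)
  refine (add_le_add e1 e2).trans_eq ?_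
  rw [hK, ← vecNorm_sq]
  ring

theorem caccioppoli_estimate_EL
    (u v : E3 → Fin 3 → ℝ) (P : E3 → ℝ) (p : ℝ)
    (hu : ContDiff ℝ (⊤ : ℕ∞) u) (hP : ContDiff ℝ (⊤ : ℕ∞) P)
    (hv : ContDiff ℝ (⊤ : ℕ∞) v)
    (hunit : ∀ x : E3, ∑ i, (v x i) ^ 2 = 1)
    (hsol : StatEL u P v)
    (hp3 : 3 ≤ p) :
    ∃ c : ℝ, 0 < c ∧ ∀ R : ℝ, 1 ≤ R →
      (∫ x in ball (0 : E3) (R / 2), gradSq u x)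
        ≤ c * ((∫ x in ann R, (vecNorm u x) ^ p) ^ (2 / p)
              + (∫ x in ann R, (gradSq v x) ^ (p / 2)) ^ (2 / p)
              + (∫ x in ann R, |P x| ^ (p / 2)) ^ (2 / p))
            * R ^ (2 - 9 / p) * (∫ x in ann R, (vecNorm u x) ^ p) ^ (1 / p)
          + c / R ^ 2 * ∫ x in ann R, ∑ i, (u x i) ^ 2 := by
  obtain ⟨M, hM, hcut⟩ := exists_cutoff
  set W := (volume : Measure E3).real (ball 0 1) ^ (1 - 3 / p) with hW
  have hW0 : 0 ≤ W := rpow_nonneg measureReal_nonneg _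
  refine ⟨3 * M * W + M, by positivity, fun R hR1 => ?_⟩
  have hR : 0 < R := by linarith
  obtain ⟨φ, hφ, hc, hφ0, hφ1, hφann, hφ', hφ''⟩ := hcut R hR
  have cu : Continuous (vecNorm u) := (continuous_finsetSum _ fun i _ =>
    (contDiff_comp_apply hu i).continuous.pow 2).sqrt
  have cg : Continuous (gradSq v) := (contDiff_gradSq hv).continuous
  have cP : Continuous fun x => |P x| := hP.continuous.abs
  have cs : Continuous fun x => ∑ i, u x i ^ 2 := continuous_finsetSum _ fun i _ =>
    (contDiff_comp_apply hu i).continuous.pow 2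
  have cK : Continuous fun x => kinetic u x * lap φ x + head u P v x * ∑ j, u x j * pd j φ x :=
    ((contDiff_kinetic hu).continuous.mul (continuous_finsetSum _ fun j _ =>
      (contDiff_pd j (contDiff_pd j hφ)).continuous)).add
    ((contDiff_head hu hP hv).continuous.mul (continuous_finsetSum _ fun j _ =>
      (contDiff_comp_apply hu j).continuous.mul (contDiff_pd j hφ).continuous))
  have c1 : Continuous fun x => M / (2 * R ^ 2) * ∑ i, u x i ^ 2 := continuous_const.mul cs
  have c2 : Continuous fun x => 3 * M / 2 * (R⁻¹ * (vecNorm u x ^ 2 * vecNorm u x)) :=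
    continuous_const.mul (continuous_const.mul ((cu.pow 2).mul cu))
  have c3 : Continuous fun x => 3 * M / 2 * (R⁻¹ * (gradSq v x * vecNorm u x)) :=
    continuous_const.mul (continuous_const.mul (cg.mul cu))
  have c4 : Continuous fun x => 3 * M * (R⁻¹ * (|P x| * vecNorm u x)) :=
    continuous_const.mul (continuous_const.mul (cP.mul cu))
  have hlocal : ∫ x in ball (0 : E3) (R / 2), gradSq u x ≤ ∫ x, φ x * gradSq u x := by
    have hint : Integrable fun x => φ x * gradSq u x :=
      (hφ.continuous.mul (contDiff_gradSq hu).continuous).integrable_of_hasCompactSupport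
        hc.mul_right
    rw [setIntegral_congr_fun (g := fun x => φ x * gradSq u x) measurableSet_ball fun x hx => by
      simp [hφ1 x hx]]
    exact setIntegral_le_integral hint
      (ae_of_all _ fun x => mul_nonneg (hφ0 x) (gradSq_nonneg u x))
  have hann : ∫ x, (kinetic u x * lap φ x + head u P v x * ∑ j, u x j * pd j φ x) =
      ∫ x in ann R, (kinetic u x * lap φ x + head u P v x * ∑ j, u x j * pd j φ x) :=
    (setIntegral_eq_integral_of_forall_compl_eq_zero fun x hx => by
      simp [(hφann x hx).1, (hφann x hx).2]).symm
  have hbound : ∫ x in ann R, (kinetic u x * lap φ x + head u P v x * ∑ j, u x j * pd j φ x) ≤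
      M / (2 * R ^ 2) * (∫ x in ann R, ∑ i, u x i ^ 2) +
        (3 * M / 2 * (R⁻¹ * ∫ x in ann R, vecNorm u x ^ 2 * vecNorm u x) +
        3 * M / 2 * (R⁻¹ * ∫ x in ann R, gradSq v x * vecNorm u x) +
        3 * M * (R⁻¹ * ∫ x in ann R, |P x| * vecNorm u x)) := by
    simp only [← integral_const_mul]
    rw [← integral_add (integrableOn_ann c2 R) (integrableOn_ann c3 R),
      ← integral_add (integrableOn_ann (c2.fun_add c3) R) (integrableOn_ann c4 R),
      ← integral_add (integrableOn_ann c1 R) (integrableOn_ann ((c2.fun_add c3).fun_add c4) R)]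
    exact integral_mono (integrableOn_ann cK R)
      (integrableOn_ann (c1.fun_add ((c2.fun_add c3).fun_add c4)) R)
      fun x => energy_integrand_le (hφ' x) (hφ'' x)
  have hu0 := vecNorm_nonneg u
  have k1 := integral_ann_mul_le (f := fun x => vecNorm u x ^ 2) hp3 hR (cu.pow 2) cu (fun x => sq_nonneg _) hu0
  have k2 := integral_ann_mul_le hp3 hR cg cu (gradSq_nonneg v) hu0
  have k3 := integral_ann_mul_le hp3 hR cP cu (fun x => abs_nonneg _) hu0
  have hpow : ∀ x, (vecNorm u x ^ 2) ^ (p / 2) = vecNorm u x ^ p := by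
    intro x
    rw [← rpow_natCast, ← rpow_mul (hu0 x)]
    congr 1
    push_cast
    ring
  simp only [hpow, ← hW] at k1 k2 k3
  have hmain := (hlocal.trans
    (integral_cutoff_mul_gradSq_le hφ hc hφ0 hu hP hv hunit hsol)).trans (hann.trans_le hbound)
  refine hmain.trans ?_
  have hS : 0 ≤ ∫ x in ann R, ∑ i, u x i ^ 2 :=
    integral_nonneg fun x => Finset.sum_nonneg fun _ _ => sq_nonneg _
  have hI1 : 0 ≤ (∫ x in ann R, vecNorm u x ^ p) ^ (2 / p) :=
    rpow_nonneg (integral_nonneg fun x => rpow_nonneg (hu0 x) _) _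
  have hI2 : 0 ≤ (∫ x in ann R, gradSq v x ^ (p / 2)) ^ (2 / p) :=
    rpow_nonneg (integral_nonneg fun x => rpow_nonneg (gradSq_nonneg v x) _) _
  have hI3 : 0 ≤ (∫ x in ann R, |P x| ^ (p / 2)) ^ (2 / p) :=
    rpow_nonneg (integral_nonneg fun x => rpow_nonneg (abs_nonneg _) _) _
  have hJ : 0 ≤ (∫ x in ann R, vecNorm u x ^ p) ^ (1 / p) :=
    rpow_nonneg (integral_nonneg fun x => rpow_nonneg (hu0 x) _) _
  have hRp : 0 ≤ R ^ (2 - 9 / p) := rpow_nonneg hR.le _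
  have hfirst : M / (2 * R ^ 2) * (∫ x in ann R, ∑ i, u x i ^ 2) ≤
      (3 * M * W + M) / R ^ 2 * ∫ x in ann R, ∑ i, u x i ^ 2 := by
    refine mul_le_mul_of_nonneg_right ?_ hS
    gcongr
    · nlinarith [mul_nonneg hM.le hW0]
    · nlinarith [sq_nonneg R]
  generalize (∫ x in ann R, vecNorm u x ^ p) ^ (2 / p) = I1 at *
  generalize (∫ x in ann R, gradSq v x ^ (p / 2)) ^ (2 / p) = I2 at *
  generalize (∫ x in ann R, |P x| ^ (p / 2)) ^ (2 / p) = I3 at *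
  generalize (∫ x in ann R, vecNorm u x ^ p) ^ (1 / p) = J at *
  generalize R ^ (2 - 9 / p) = r at *
  have q1 := mul_le_mul_of_nonneg_left k1 (by positivity : 0 ≤ 3 * M / 2)
  have q2 := mul_le_mul_of_nonneg_left k2 (by positivity : 0 ≤ 3 * M / 2)
  have q3 := mul_le_mul_of_nonneg_left k3 (by positivity : 0 ≤ 3 * M)
  have hslack : 0 ≤ 3 * M / 2 * W * ((I1 + I2) * r * J) + M * ((I1 + I2 + I3) * r * J) := by
    positivity
  linarith
end
end

section
/- Let 0 < γ < 3 and 1 < p < +∞. There exists a constant c = c(p,γ) > 0 such that for every f ∈ M^p_γ(ℝ³), the Hardy–Littlewood maximal function Mf(x) = sup_{r > 0} |B(x,r)|^{−1} ∫_{B(x,r)} |f(y)| dy satisfies sup_{R ≥ 1} ( R^{−γ} ∫_{B_R} (Mf)^p dx )^{1/p} ≤ c · sup_{R ≥ 1} ( R^{−γ} ∫_{B_R} |f|^p dx )^{1/p}; in particular Mf ∈ M^p_γ(ℝ³). -/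
open MeasureTheory Filter Metric Real

noncomputable section

/-- The Hardy–Littlewood maximal function
`Mf(x) = sup_{r>0} |B(x,r)|⁻¹ ∫_{B(x,r)} |f|`. -/
def maxFn (f : E3 → ℝ) (x : E3) : ENNReal :=
  ⨆ (r : ℝ) (_ : 0 < r),
    (volume (ball x r))⁻¹ * ∫⁻ y in ball x r, ENNReal.ofReal |f y|

/-- The maximal function of an `ENNReal`-valued function. -/
def emaxFn (g : E3 → ENNReal) (x : E3) : ENNReal :=
  ⨆ (r : ℝ) (_ : 0 < r), (volume (ball x r))⁻¹ * ∫⁻ y in ball x r, g y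

theorem le_emaxFn (g : E3 → ENNReal) (x : E3) {r : ℝ} (hr : 0 < r) :
    (volume (ball x r))⁻¹ * ∫⁻ y in ball x r, g y ≤ emaxFn g x :=
  le_iSup₂_of_le r hr le_rfl

theorem lt_emaxFn_iff {g : E3 → ENNReal} {x : E3} {a : ENNReal} :
    a < emaxFn g x ↔ ∃ r : ℝ, 0 < r ∧ a < (volume (ball x r))⁻¹ * ∫⁻ y in ball x r, g y := by
  simp [emaxFn, lt_iSup_iff]

theorem volume_ball_E3 (x : E3) {r : ℝ} (hr : 0 ≤ r) :
    volume (ball x r) = ENNReal.ofReal (r ^ 3) * volume (ball (0 : E3) 1) := by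
  have := Measure.addHaar_ball (volume : Measure E3) x hr
  simpa using this

theorem volume_ball_mul_E3 (x : E3) {s r : ℝ} (hs : 0 ≤ s) (hr : 0 ≤ r) :
    volume (ball x (s * r)) = ENNReal.ofReal (s ^ 3) * volume (ball x r) := by
  rw [volume_ball_E3 x (mul_nonneg hs hr), volume_ball_E3 x hr, mul_pow,
    ENNReal.ofReal_mul (by positivity), mul_assoc]

theorem volume_ball_E3_ne_zero (x : E3) {r : ℝ} (hr : 0 < r) : volume (ball x r) ≠ 0 :=
  (measure_ball_pos volume x hr).ne'

theorem volume_ball_E3_ne_top (x : E3) (r : ℝ) : volume (ball x r) ≠ ⊤ :=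
  measure_ball_lt_top.ne

theorem lowerSemicontinuous_setLIntegral_ball (g : E3 → ENNReal) (r : ℝ) :
    LowerSemicontinuous fun x => ∫⁻ y in ball x r, g y := by
  intro x a ha
  have hU : ball x r = ⋃ n : ℕ, ball x (r - 1 / ((n : ℝ) + 1)) := by
    ext y
    simp only [mem_ball, Set.mem_iUnion]
    constructor
    · intro h
      obtain ⟨n, hn⟩ := exists_nat_one_div_lt (sub_pos.2 h)
      exact ⟨n, by linarith⟩
    · rintro ⟨n, hn⟩
      have : (0 : ℝ) < 1 / ((n : ℝ) + 1) := by positivity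
      linarith
  have hmono : Monotone fun n : ℕ => ball x (r - 1 / ((n : ℝ) + 1)) := by
    intro m n hmn
    refine ball_subset_ball ?_
    have : 1 / ((n : ℝ) + 1) ≤ 1 / ((m : ℝ) + 1) := by gcongr
    linarith
  have ha' : a < ∫⁻ y in ball x r, g y := ha
  rw [hU, setLIntegral_iUnion_of_directed _ hmono.directed_le, lt_iSup_iff] at ha'
  obtain ⟨n, hn⟩ := ha'
  have hpos : (0 : ℝ) < 1 / ((n : ℝ) + 1) := by positivity
  filter_upwards [ball_mem_nhds x hpos] with z hz
  refine hn.trans_le (lintegral_mono_set (ball_subset_ball' ?_))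
  rw [dist_comm]
  rw [mem_ball] at hz
  linarith

theorem lowerSemicontinuous_emaxFn (g : E3 → ENNReal) : LowerSemicontinuous (emaxFn g) := by
  intro x a ha
  obtain ⟨r, hr, h⟩ := lt_emaxFn_iff.1 ha
  have h0 := volume_ball_E3_ne_zero x hr
  have ht := volume_ball_E3_ne_top x r
  have h' : a * volume (ball x r) < ∫⁻ y in ball x r, g y := by
    rwa [← ENNReal.lt_div_iff_mul_lt (Or.inl h0) (Or.inl ht), ENNReal.div_eq_inv_mul]
  filter_upwards [lowerSemicontinuous_setLIntegral_ball g r x _ h'] with z hz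
  refine lt_emaxFn_iff.2 ⟨r, hr, ?_⟩
  have hv : volume (ball z r) = volume (ball x r) := by
    rw [volume_ball_E3 z hr.le, volume_ball_E3 x hr.le]
  rw [hv, ← ENNReal.div_eq_inv_mul]
  exact (ENNReal.lt_div_iff_mul_lt (Or.inl h0) (Or.inl ht)).2 hz

/-- Weak type (1,1) estimate for the maximal function. -/
theorem mul_volume_lt_emaxFn_le (g : E3 → ENNReal) {a : ENNReal} (ha0 : a ≠ 0) (hat : a ≠ ⊤) :
    a * volume {x | a < emaxFn g x} ≤ 64 * ∫⁻ y, g y := by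
  by_cases hg : ∫⁻ y, g y = ⊤
  · rw [hg, ENNReal.mul_top (by norm_num)]
    exact le_top
  have hex : ∀ x : E3, ∃ r : ℝ, a < emaxFn g x →
      0 < r ∧ a * volume (ball x r) ≤ ∫⁻ y in ball x r, g y := by
    intro x
    by_cases hx : a < emaxFn g x
    · obtain ⟨r, hr, h⟩ := lt_emaxFn_iff.1 hx
      refine ⟨r, fun _ => ⟨hr, ?_⟩⟩
      rw [← ENNReal.div_eq_inv_mul] at h
      exact ((ENNReal.lt_div_iff_mul_lt (Or.inl (volume_ball_E3_ne_zero x hr))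
        (Or.inl (volume_ball_E3_ne_top x r))).1 h).le
    · exact ⟨0, fun h => absurd h hx⟩
  choose r hr using hex
  set v : ENNReal := volume (ball (0 : E3) 1) with hv
  have hv0 : v ≠ 0 := volume_ball_E3_ne_zero 0 one_pos
  have hvt : v ≠ ⊤ := volume_ball_E3_ne_top 0 1
  set K : ENNReal := (∫⁻ y, g y) / (a * v) with hK
  have hKt : K ≠ ⊤ := ENNReal.div_ne_top hg (mul_ne_zero ha0 hv0)
  have hbound : ∀ x ∈ {x | a < emaxFn g x}, r x ≤ max 1 K.toReal := by
    intro x hx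
    obtain ⟨hrx, h⟩ := hr x hx
    by_contra! hcon
    obtain ⟨h1, h2⟩ := max_lt_iff.1 hcon
    have h3 : ENNReal.ofReal (r x ^ 3) ≤ K := by
      rw [hK, ENNReal.le_div_iff_mul_le (Or.inl (mul_ne_zero ha0 hv0))
        (Or.inl (ENNReal.mul_ne_top hat hvt))]
      calc ENNReal.ofReal (r x ^ 3) * (a * v) = a * volume (ball x (r x)) := by
            rw [volume_ball_E3 x hrx.le]; ring
        _ ≤ ∫⁻ y in ball x (r x), g y := h
        _ ≤ ∫⁻ y, g y := setLIntegral_le_lintegral _ _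
    have h4 := (ENNReal.ofReal_le_iff_le_toReal hKt).1 h3
    have h5 : r x ≤ r x ^ 3 := le_self_pow₀ h1.le (by norm_num)
    linarith
  obtain ⟨u, hut, hdisj, hcov⟩ := Vitali.exists_disjoint_subfamily_covering_enlargement_ball
    {x | a < emaxFn g x} (fun x => x) r _ hbound 4 (by norm_num)
  have hcount : u.Countable := hdisj.countable_of_isOpen (fun _ _ => isOpen_ball)
    (fun x hx => nonempty_ball.2 (hr x (hut hx)).1)
  have hsub : {x | a < emaxFn g x} ⊆ ⋃ x ∈ u, ball x (4 * r x) := by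
    intro x hx
    obtain ⟨b, hb, h⟩ := hcov x hx
    exact Set.mem_biUnion hb (h (mem_ball_self (hr x hx).1))
  calc a * volume {x | a < emaxFn g x}
      ≤ a * ∑' x : u, volume (ball (x : E3) (4 * r x)) := by
        gcongr
        exact (measure_mono hsub).trans (measure_biUnion_le _ hcount _)
    _ = ∑' x : u, 64 * (a * volume (ball (x : E3) (r x))) := by
        rw [← ENNReal.tsum_mul_left]
        congr 1 with x
        rw [volume_ball_mul_E3 _ (by norm_num) (hr x (hut x.2)).1.le]
        norm_num
        ring
    _ ≤ ∑' x : u, 64 * ∫⁻ y in ball (x : E3) (r x), g y := by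
        gcongr with x
        exact (hr x (hut x.2)).2
    _ = 64 * ∫⁻ y in ⋃ x ∈ u, ball x (r x), g y := by
        rw [ENNReal.tsum_mul_left, lintegral_biUnion hcount (fun _ _ => measurableSet_ball) hdisj]
    _ ≤ 64 * ∫⁻ y, g y := mul_le_mul_right (setLIntegral_le_lintegral _ _) _

theorem lintegral_indicator_Ioi_rpow {q : ℝ} (hq : 0 < q) (a : ENNReal) :
    ∫⁻ t in Set.Ioi (0 : ℝ),
      {t : ℝ | ENNReal.ofReal t < a}.indicator (fun t => ENNReal.ofReal (t ^ (q - 1))) t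
      = a ^ q / ENNReal.ofReal q := by
  have hreal : ∀ b : ℝ, 0 ≤ b → ∫⁻ t in Set.Ioo (0 : ℝ) b, ENNReal.ofReal (t ^ (q - 1))
      = ENNReal.ofReal b ^ q / ENNReal.ofReal q := by
    intro b hb
    have hint : IntervalIntegrable (fun t : ℝ => t ^ (q - 1)) volume 0 b :=
      intervalIntegral.intervalIntegrable_rpow' (by linarith)
    rw [intervalIntegrable_iff_integrableOn_Ioo_of_le hb] at hint
    rw [← ofReal_integral_eq_lintegral_ofReal hint, ← integral_Ioc_eq_integral_Ioo,
      ← intervalIntegral.integral_of_le hb, integral_rpow (Or.inl (by linarith)),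
      sub_add_cancel, Real.zero_rpow hq.ne', sub_zero, ENNReal.ofReal_div_of_pos hq,
      ENNReal.ofReal_rpow_of_nonneg hb hq.le]
    filter_upwards [ae_restrict_mem measurableSet_Ioo] with t ht
    exact Real.rpow_nonneg ht.1.le _
  have hm : MeasurableSet {t : ℝ | ENNReal.ofReal t < a} :=
    measurableSet_lt ENNReal.measurable_ofReal measurable_const
  rw [setLIntegral_indicator hm]
  rcases eq_or_ne a ⊤ with rfl | ha
  · rw [ENNReal.top_rpow_of_pos hq, ENNReal.top_div_of_ne_top ENNReal.ofReal_ne_top]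
    refine ENNReal.eq_top_of_forall_nnreal_le fun s => ?_
    set b : ℝ := (q * s) ^ (1 / q) with hb
    have hb0 : 0 ≤ b := by positivity
    have hbq : b ^ q = q * s := by
      rw [hb, ← Real.rpow_mul (by positivity), one_div, inv_mul_cancel₀ hq.ne', Real.rpow_one]
    calc (s : ENNReal) = ENNReal.ofReal b ^ q / ENNReal.ofReal q := by
          rw [ENNReal.ofReal_rpow_of_nonneg hb0 hq.le, ← ENNReal.ofReal_div_of_pos hq, hbq,
            mul_div_cancel_left₀ _ hq.ne', ENNReal.ofReal_coe_nnreal]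
      _ = ∫⁻ t in Set.Ioo (0 : ℝ) b, ENNReal.ofReal (t ^ (q - 1)) := (hreal b hb0).symm
      _ ≤ _ := lintegral_mono_set (by
          intro t ht
          exact ⟨ENNReal.ofReal_lt_top, ht.1⟩)
  · have hset : {t : ℝ | ENNReal.ofReal t < a} ∩ Set.Ioi 0 = Set.Ioo 0 a.toReal := by
      ext t
      simp only [Set.mem_inter_iff, Set.mem_ofPred_eq, Set.mem_Ioi, Set.mem_Ioo]
      rw [and_comm]
      refine and_congr_right fun ht => ?_
      rw [ENNReal.ofReal_lt_iff_lt_toReal ht.le ha]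
    rw [hset, hreal _ ENNReal.toReal_nonneg, ENNReal.ofReal_toReal ha]

/-- Layer cake formula for powers of `ENNReal`-valued functions. -/
theorem lintegral_rpow_eq_layercake {q : ℝ} (hq : 0 < q) {h : E3 → ENNReal} (hh : Measurable h)
    {w : E3 → ENNReal} (hw : Measurable w) :
    ∫⁻ t in Set.Ioi (0 : ℝ), ENNReal.ofReal (t ^ (q - 1)) *
        ∫⁻ x in {x | ENNReal.ofReal t < h x}, w x
      = (∫⁻ x, w x * h x ^ q) / ENNReal.ofReal q := by
  have hset : MeasurableSet {z : ℝ × E3 | ENNReal.ofReal z.1 < h z.2} :=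
    measurableSet_lt (ENNReal.measurable_ofReal.comp measurable_fst) (hh.comp measurable_snd)
  have hF : Measurable fun z : ℝ × E3 => {z : ℝ × E3 | ENNReal.ofReal z.1 < h z.2}.indicator
      (fun z => ENNReal.ofReal (z.1 ^ (q - 1)) * w z.2) z := by
    refine Measurable.indicator ?_ hset
    fun_prop
  calc ∫⁻ t in Set.Ioi (0 : ℝ), ENNReal.ofReal (t ^ (q - 1)) *
        ∫⁻ x in {x | ENNReal.ofReal t < h x}, w x
      = ∫⁻ t in Set.Ioi (0 : ℝ), ∫⁻ x, {z : ℝ × E3 | ENNReal.ofReal z.1 < h z.2}.indicator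
          (fun z => ENNReal.ofReal (z.1 ^ (q - 1)) * w z.2) (t, x) := by
        congr 1 with t
        rw [← lintegral_indicator (measurableSet_lt measurable_const hh),
          ← lintegral_const_mul _ (hw.indicator (measurableSet_lt measurable_const hh))]
        congr 1 with x
        by_cases hx : ENNReal.ofReal t < h x <;> simp [Set.indicator, hx]
    _ = ∫⁻ x, ∫⁻ t in Set.Ioi (0 : ℝ), {z : ℝ × E3 | ENNReal.ofReal z.1 < h z.2}.indicator
          (fun z => ENNReal.ofReal (z.1 ^ (q - 1)) * w z.2) (t, x) :=
        lintegral_lintegral_swap hF.aemeasurable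
    _ = ∫⁻ x, w x * (h x ^ q / ENNReal.ofReal q) := by
        congr 1 with x
        rw [← lintegral_indicator_Ioi_rpow hq, ← lintegral_const_mul]
        · congr 1 with t
          by_cases hx : ENNReal.ofReal t < h x <;> simp [Set.indicator, hx, mul_comm]
        · refine Measurable.indicator (by fun_prop)
            (measurableSet_lt ENNReal.measurable_ofReal measurable_const)
    _ = (∫⁻ x, w x * h x ^ q) / ENNReal.ofReal q := by
        simp only [div_eq_mul_inv, ← mul_assoc]
        rw [lintegral_mul_const _ (by fun_prop)]

theorem mul_volume_lt_emaxFn_le_setLIntegral {g : E3 → ENNReal} (hg : Measurable g) {t : ℝ}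
    (ht : 0 < t) :
    ENNReal.ofReal t * volume {x | ENNReal.ofReal t < emaxFn g x} ≤
      128 * ∫⁻ x in {x | ENNReal.ofReal t < 2 * g x}, g x := by
  set s : Set E3 := {x | ENNReal.ofReal t < 2 * g x} with hs
  have hsm : MeasurableSet s := measurableSet_lt measurable_const (by fun_prop)
  set b : ENNReal := ENNReal.ofReal (t / 2) with hb
  have hbb : b + b = ENNReal.ofReal t := by
    rw [hb, ← ENNReal.ofReal_add (by positivity) (by positivity), add_halves]
  have hle : ∀ x, g x ≤ s.indicator g x + b := by
    intro x
    by_cases hx : x ∈ s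
    · simp [hx]
    · rw [Set.indicator_of_notMem hx, zero_add]
      have : 2 * g x ≤ 2 * b := by
        rw [two_mul b, hbb]
        exact not_lt.1 hx
      exact (ENNReal.mul_le_mul_iff_right (by norm_num) (by norm_num)).1 this
  have hsub : {x | ENNReal.ofReal t < emaxFn g x} ⊆ {x | b < emaxFn (s.indicator g) x} := by
    intro x hx
    obtain ⟨r, hr, h⟩ := lt_emaxFn_iff.1 hx
    have h0 := volume_ball_E3_ne_zero x hr
    have hT := volume_ball_E3_ne_top x r
    refine lt_emaxFn_iff.2 ⟨r, hr, ?_⟩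
    by_contra! hcon
    refine absurd h (not_lt.2 ?_)
    calc (volume (ball x r))⁻¹ * ∫⁻ y in ball x r, g y
        ≤ (volume (ball x r))⁻¹ * ∫⁻ y in ball x r, (s.indicator g y + b) := by
          gcongr with y
          exact hle y
      _ = (volume (ball x r))⁻¹ * (∫⁻ y in ball x r, s.indicator g y) + b := by
          rw [lintegral_add_right _ measurable_const, setLIntegral_const, mul_add, mul_comm b,
            ← mul_assoc, ENNReal.inv_mul_cancel h0 hT, one_mul]
      _ ≤ b + b := by gcongr
      _ = ENNReal.ofReal t := hbb
  have hb0 : b ≠ 0 := by simpa [hb] using ht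
  calc ENNReal.ofReal t * volume {x | ENNReal.ofReal t < emaxFn g x}
      ≤ (b + b) * volume {x | b < emaxFn (s.indicator g) x} := by
        rw [hbb]
        gcongr
    _ = 2 * (b * volume {x | b < emaxFn (s.indicator g) x}) := by ring
    _ ≤ 2 * (64 * ∫⁻ x, s.indicator g x) :=
        mul_le_mul_right (mul_volume_lt_emaxFn_le _ hb0 ENNReal.ofReal_ne_top) _
    _ = 128 * ∫⁻ x in s, g x := by
        rw [lintegral_indicator hsm, ← mul_assoc]
        norm_num

/-- The Hardy–Littlewood maximal theorem. -/
theorem exists_lintegral_emaxFn_rpow_le {p : ℝ} (hp : 1 < p) :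
    ∃ C : ENNReal, C ≠ ⊤ ∧ ∀ g : E3 → ENNReal, Measurable g →
      ∫⁻ x, emaxFn g x ^ p ≤ C * ∫⁻ x, g x ^ p := by
  have hp0 : 0 < p := by linarith
  have hq : 0 < p - 1 := by linarith
  refine ⟨ENNReal.ofReal p * (128 * (2 ^ (p - 1) / ENNReal.ofReal (p - 1))), ?_, ?_⟩
  · refine ENNReal.mul_ne_top ENNReal.ofReal_ne_top (ENNReal.mul_ne_top (by norm_num) ?_)
    refine ENNReal.div_ne_top (ENNReal.rpow_ne_top_of_nonneg hq.le (by norm_num)) ?_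
    simpa using hp
  intro g hg
  have hM : Measurable (emaxFn g) := (lowerSemicontinuous_emaxFn g).measurable
  have h1 := lintegral_rpow_eq_layercake hp0 hM (w := fun _ => 1) measurable_const
  have h2 := lintegral_rpow_eq_layercake hq (h := fun x => 2 * g x) (by fun_prop) hg
  have h3 : (∫⁻ x, emaxFn g x ^ p) / ENNReal.ofReal p ≤
      128 * ((∫⁻ x, g x * (2 * g x) ^ (p - 1)) / ENNReal.ofReal (p - 1)) := by
    rw [← h2, ← lintegral_const_mul']
    · simp only [one_mul] at h1
      rw [← h1]
      refine setLIntegral_mono' measurableSet_Ioi fun t ht => ?_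
      have ht : 0 < t := ht
      rw [setLIntegral_one]
      calc ENNReal.ofReal (t ^ (p - 1)) * volume {x | ENNReal.ofReal t < emaxFn g x}
          = ENNReal.ofReal (t ^ (p - 1 - 1)) *
            (ENNReal.ofReal t * volume {x | ENNReal.ofReal t < emaxFn g x}) := by
            rw [← mul_assoc, ← ENNReal.ofReal_mul (by positivity), ← Real.rpow_add_one ht.ne',
              sub_add_cancel]
        _ ≤ ENNReal.ofReal (t ^ (p - 1 - 1)) *
            (128 * ∫⁻ x in {x | ENNReal.ofReal t < 2 * g x}, g x) :=
            mul_le_mul_right (mul_volume_lt_emaxFn_le_setLIntegral hg ht) _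
        _ = _ := by ring
    · norm_num
  have h4 : ∫⁻ x, g x * (2 * g x) ^ (p - 1) = 2 ^ (p - 1) * ∫⁻ x, g x ^ p := by
    rw [← lintegral_const_mul _ (by fun_prop)]
    congr 1 with x
    rw [ENNReal.mul_rpow_of_nonneg _ _ hq.le, mul_left_comm]
    congr 1
    nth_rewrite 1 [← ENNReal.rpow_one (g x)]
    rw [← ENNReal.rpow_add_of_nonneg _ _ zero_le_one hq.le, add_sub_cancel]
  rw [ENNReal.div_le_iff (by simpa using hp0) ENNReal.ofReal_ne_top, h4] at h3
  refine h3.trans_eq ?_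
  simp only [div_eq_mul_inv]
  ring

/-- Jensen's inequality for powers on a set. -/
theorem setLIntegral_rpow_le {p : ℝ} (hp : 1 < p) {g : E3 → ENNReal} (hg : Measurable g)
    (s : Set E3) :
    (∫⁻ x in s, g x) ^ p ≤ volume s ^ (p - 1) * ∫⁻ x in s, g x ^ p := by
  have hp0 : 0 < p := by linarith
  have hpq := Real.HolderConjugate.conjExponent hp
  have h := ENNReal.lintegral_mul_le_Lp_mul_Lq (volume.restrict s) hpq hg.aemeasurable
    (aemeasurable_const (b := (1 : ENNReal)))
  simp only [Pi.mul_apply, mul_one, ENNReal.one_rpow, setLIntegral_one] at h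
  calc (∫⁻ x in s, g x) ^ p
      ≤ ((∫⁻ x in s, g x ^ p) ^ (1 / p) * volume s ^ (1 / Real.conjExponent p)) ^ p := by gcongr
    _ = volume s ^ (p - 1) * ∫⁻ x in s, g x ^ p := by
        rw [ENNReal.mul_rpow_of_nonneg _ _ hp0.le, ← ENNReal.rpow_mul, ← ENNReal.rpow_mul,
          one_div_mul_cancel hp0.ne', ENNReal.rpow_one, mul_comm]
        congr 2
        rw [Real.conjExponent]
        field_simp

/-- Averages over balls whose radius exceeds the distance to the origin. -/
theorem volume_mul_average_rpow_le {γ p : ℝ} (hγ3 : γ < 3) (hp : 1 < p)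
    {g : E3 → ENNReal} (hg : Measurable g) {N : ENNReal}
    (hN : ∀ R : ℝ, 1 ≤ R → ∫⁻ x in ball (0 : E3) R, g x ^ p ≤ ENNReal.ofReal (R ^ γ) * N)
    {R r : ℝ} (hR : 1 ≤ R) (hr : R ≤ r) {x : E3} (hx : x ∈ ball (0 : E3) R) :
    ((volume (ball x r))⁻¹ * ∫⁻ y in ball x r, g y) ^ p * volume (ball (0 : E3) R) ≤
      8 ^ (p - 1) * ENNReal.ofReal (2 ^ γ) * N * ENNReal.ofReal (R ^ γ) := by
  have hp0 : 0 < p := by linarith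
  have hR0 : 0 < R := by linarith
  have hr0 : 0 < r := by linarith
  set V : ENNReal := volume (ball (0 : E3) r) with hV
  have hV0 : V ≠ 0 := volume_ball_E3_ne_zero 0 hr0
  have hVt : V ≠ ⊤ := volume_ball_E3_ne_top 0 r
  have hVx : volume (ball x r) = V := by rw [hV, volume_ball_E3 x hr0.le, volume_ball_E3 0 hr0.le]
  have hV2 : volume (ball (0 : E3) (2 * r)) = 8 * V := by
    rw [volume_ball_mul_E3 0 (by norm_num) hr0.le, ← hV]
    norm_num
  have hsub : ball x r ⊆ ball (0 : E3) (2 * r) := by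
    refine ball_subset_ball' ?_
    rw [mem_ball] at hx
    linarith
  have hint : (∫⁻ y in ball x r, g y) ^ p ≤
      (8 * V) ^ (p - 1) * (ENNReal.ofReal ((2 * r) ^ γ) * N) := by
    calc (∫⁻ y in ball x r, g y) ^ p ≤ (∫⁻ y in ball (0 : E3) (2 * r), g y) ^ p := by
          gcongr
      _ ≤ _ := setLIntegral_rpow_le hp hg _
      _ ≤ _ := by
          rw [hV2]
          gcongr
          exact hN _ (by linarith)
  have hVR : V⁻¹ * volume (ball (0 : E3) R) = ENNReal.ofReal ((R / r) ^ 3) := by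
    have : volume (ball (0 : E3) R) = ENNReal.ofReal ((R / r) ^ 3) * V := by
      rw [hV, ← volume_ball_mul_E3 0 (by positivity) hr0.le, div_mul_cancel₀ _ hr0.ne']
    rw [this, mul_left_comm, ENNReal.inv_mul_cancel hV0 hVt, mul_one]
  have hpow : (R / r) ^ 3 * (2 * r) ^ γ ≤ 2 ^ γ * R ^ γ := by
    rw [Real.mul_rpow (by norm_num) hr0.le]
    have h1 : (R / r) ^ (3 : ℕ) ≤ (R / r) ^ γ := by
      rw [← Real.rpow_natCast]
      exact Real.rpow_le_rpow_of_exponent_ge (by positivity) ((div_le_one hr0).2 hr)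
        (by push_cast; exact hγ3.le)
    calc (R / r) ^ 3 * (2 ^ γ * r ^ γ) ≤ (R / r) ^ γ * (2 ^ γ * r ^ γ) := by gcongr
      _ = 2 ^ γ * R ^ γ := by
          rw [Real.div_rpow hR0.le hr0.le]
          field_simp
  have hVp : V⁻¹ ^ p * V ^ (p - 1) = V⁻¹ := by
    rw [ENNReal.inv_rpow, ← ENNReal.rpow_neg, ← ENNReal.rpow_add _ _ hV0 hVt,
      ← ENNReal.rpow_neg_one]
    congr 1
    ring
  calc ((volume (ball x r))⁻¹ * ∫⁻ y in ball x r, g y) ^ p * volume (ball (0 : E3) R)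
      = V⁻¹ ^ p * (∫⁻ y in ball x r, g y) ^ p * volume (ball (0 : E3) R) := by
        rw [hVx, ENNReal.mul_rpow_of_nonneg _ _ hp0.le]
    _ ≤ V⁻¹ ^ p * ((8 * V) ^ (p - 1) * (ENNReal.ofReal ((2 * r) ^ γ) * N)) *
          volume (ball (0 : E3) R) := by gcongr
    _ = 8 ^ (p - 1) * N * ((V⁻¹ ^ p * V ^ (p - 1)) * volume (ball (0 : E3) R) *
          ENNReal.ofReal ((2 * r) ^ γ)) := by
        rw [ENNReal.mul_rpow_of_nonneg _ _ (by linarith : 0 ≤ p - 1)]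
        ring
    _ = 8 ^ (p - 1) * N * ENNReal.ofReal ((R / r) ^ 3 * (2 * r) ^ γ) := by
        rw [hVp, hVR, ENNReal.ofReal_mul (by positivity)]
    _ ≤ 8 ^ (p - 1) * N * ENNReal.ofReal (2 ^ γ * R ^ γ) := by gcongr
    _ = _ := by
        rw [ENNReal.ofReal_mul (by positivity)]
        ring

theorem exists_setLIntegral_emaxFn_rpow_le {γ p : ℝ} (hγ3 : γ < 3) (hp : 1 < p) :
    ∃ C : ENNReal, C ≠ ⊤ ∧ ∀ g : E3 → ENNReal, Measurable g → ∀ N : ENNReal,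
      (∀ R : ℝ, 1 ≤ R → ∫⁻ x in ball (0 : E3) R, g x ^ p ≤ ENNReal.ofReal (R ^ γ) * N) →
      ∀ R : ℝ, 1 ≤ R →
        ∫⁻ x in ball (0 : E3) R, emaxFn g x ^ p ≤ C * (ENNReal.ofReal (R ^ γ) * N) := by
  obtain ⟨C, hC, hmax⟩ := exists_lintegral_emaxFn_rpow_le hp
  have hp0 : 0 < p := by linarith
  set D : ENNReal := ENNReal.ofReal (2 ^ γ) with hD
  refine ⟨C * D + 8 ^ (p - 1) * D, ?_, ?_⟩
  · have : (8 : ENNReal) ^ (p - 1) ≠ ⊤ :=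
      ENNReal.rpow_ne_top_of_nonneg (by linarith) (by norm_num)
    finiteness
  intro g hg N hN R hR
  have hR0 : 0 < R := by linarith
  set V : ENNReal := volume (ball (0 : E3) R) with hV
  have hV0 : V ≠ 0 := volume_ball_E3_ne_zero 0 hR0
  have hVt : V ≠ ⊤ := volume_ball_E3_ne_top 0 R
  set g₁ : E3 → ENNReal := (ball (0 : E3) (2 * R)).indicator g with hg₁
  have hg₁m : Measurable g₁ := hg.indicator measurableSet_ball
  set A : ENNReal := 8 ^ (p - 1) * D * N * ENNReal.ofReal (R ^ γ) / V with hA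
  have hpt : ∀ x ∈ ball (0 : E3) R, emaxFn g x ^ p ≤ emaxFn g₁ x ^ p + A := by
    intro x hx
    have hle : emaxFn g x ≤ (emaxFn g₁ x ^ p + A) ^ (1 / p) := by
      refine iSup₂_le fun r hr => ?_
      rw [one_div, ENNReal.le_rpow_inv_iff hp0]
      rcases le_total r R with hrR | hrR
      · have hsub : ball x r ⊆ ball (0 : E3) (2 * R) := by
          refine ball_subset_ball' ?_
          rw [mem_ball] at hx
          linarith
        have heq : ∫⁻ y in ball x r, g y = ∫⁻ y in ball x r, g₁ y :=
          setLIntegral_congr_fun measurableSet_ball fun y hy =>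
            (Set.indicator_of_mem (hsub hy) g).symm
        rw [heq]
        refine le_add_right ?_
        gcongr
        exact le_emaxFn g₁ x hr
      · refine le_add_left ?_
        rw [hA, ENNReal.le_div_iff_mul_le (Or.inl hV0) (Or.inl hVt)]
        exact volume_mul_average_rpow_le hγ3 hp hg hN hR hrR hx
    rwa [one_div, ENNReal.le_rpow_inv_iff hp0] at hle
  calc ∫⁻ x in ball (0 : E3) R, emaxFn g x ^ p
      ≤ ∫⁻ x in ball (0 : E3) R, (emaxFn g₁ x ^ p + A) :=
        setLIntegral_mono' measurableSet_ball hpt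
    _ = (∫⁻ x in ball (0 : E3) R, emaxFn g₁ x ^ p) + A * V := by
        rw [lintegral_add_right _ measurable_const, setLIntegral_const]
    _ ≤ C * (∫⁻ x, g₁ x ^ p) + A * V := by
        gcongr
        exact (setLIntegral_le_lintegral _ _).trans (hmax g₁ hg₁m)
    _ = C * (∫⁻ x in ball (0 : E3) (2 * R), g x ^ p) + A * V := by
        rw [← lintegral_indicator measurableSet_ball]
        congr 3 with x
        by_cases hx : x ∈ ball (0 : E3) (2 * R)
        · simp only [hg₁, Set.indicator_of_mem hx]
        · simp only [hg₁, Set.indicator_of_notMem hx, ENNReal.zero_rpow_of_pos hp0]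
    _ ≤ C * (ENNReal.ofReal ((2 * R) ^ γ) * N) + A * V := by
        gcongr
        exact hN _ (by linarith)
    _ = _ := by
        rw [hA, ENNReal.div_mul_cancel hV0 hVt, Real.mul_rpow (by norm_num) hR0.le,
          ENNReal.ofReal_mul (by positivity)]
        ring

theorem maximal_function_localMorrey
    (γ p : ℝ) (hγ0 : 0 < γ) (hγ3 : γ < 3) (hp : 1 < p) :
    ∃ c : ℝ, 0 < c ∧ ∀ f : E3 → ℝ, Measurable f →
      (⨆ (R : ℝ) (_ : 1 ≤ R),
          ((ENNReal.ofReal R) ^ (-γ) *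
            ∫⁻ x in ball (0 : E3) R, maxFn f x ^ p) ^ (1 / p))
        ≤ ENNReal.ofReal c *
          ⨆ (R : ℝ) (_ : 1 ≤ R),
            ((ENNReal.ofReal R) ^ (-γ) *
              ∫⁻ x in ball (0 : E3) R, (ENNReal.ofReal |f x|) ^ p) ^ (1 / p) := by
  obtain ⟨C, hC, hmain⟩ := exists_setLIntegral_emaxFn_rpow_le hγ3 hp
  have hp0 : 0 < p := by linarith
  have hCp : C ^ (1 / p) ≠ ⊤ := ENNReal.rpow_ne_top_of_nonneg (by positivity) hC
  refine ⟨(C ^ (1 / p)).toReal + 1, by positivity, fun f hf => ?_⟩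
  set S : ENNReal := ⨆ (R : ℝ) (_ : 1 ≤ R), ((ENNReal.ofReal R) ^ (-γ) *
    ∫⁻ x in ball (0 : E3) R, (ENNReal.ofReal |f x|) ^ p) ^ (1 / p) with hS
  have hcancel : ∀ R : ℝ, 1 ≤ R → ENNReal.ofReal R ^ (-γ) * ENNReal.ofReal (R ^ γ) = 1 := by
    intro R hR
    have hR0 : 0 < R := by linarith
    rw [ENNReal.ofReal_rpow_of_pos hR0, ← ENNReal.ofReal_mul (by positivity),
      ← Real.rpow_add hR0]
    simp
  have hN : ∀ R : ℝ, 1 ≤ R → ∫⁻ x in ball (0 : E3) R, (ENNReal.ofReal |f x|) ^ p ≤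
      ENNReal.ofReal (R ^ γ) * S ^ p := by
    intro R hR
    have h : ((ENNReal.ofReal R) ^ (-γ) *
        ∫⁻ x in ball (0 : E3) R, (ENNReal.ofReal |f x|) ^ p) ^ (1 / p) ≤ S :=
      le_iSup₂_of_le R hR le_rfl
    rw [one_div, ENNReal.rpow_inv_le_iff hp0] at h
    calc ∫⁻ x in ball (0 : E3) R, (ENNReal.ofReal |f x|) ^ p
        = ENNReal.ofReal (R ^ γ) * ((ENNReal.ofReal R) ^ (-γ) *
          ∫⁻ x in ball (0 : E3) R, (ENNReal.ofReal |f x|) ^ p) := by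
          rw [← mul_assoc, mul_comm (ENNReal.ofReal (R ^ γ)), hcancel R hR, one_mul]
      _ ≤ _ := by gcongr
  refine iSup₂_le fun R hR => ?_
  calc ((ENNReal.ofReal R) ^ (-γ) * ∫⁻ x in ball (0 : E3) R, maxFn f x ^ p) ^ (1 / p)
      ≤ ((ENNReal.ofReal R) ^ (-γ) * (C * (ENNReal.ofReal (R ^ γ) * S ^ p))) ^ (1 / p) := by
        gcongr
        exact hmain (fun x => ENNReal.ofReal |f x|) (by fun_prop) _ hN R hR
    _ = (C * S ^ p) ^ (1 / p) := by
        rw [mul_left_comm, ← mul_assoc (ENNReal.ofReal R ^ (-γ)), hcancel R hR, one_mul]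
    _ = C ^ (1 / p) * S := by
        rw [ENNReal.mul_rpow_of_nonneg _ _ (by positivity), ← ENNReal.rpow_mul,
          mul_one_div_cancel hp0.ne', ENNReal.rpow_one]
    _ ≤ _ := by
        gcongr
        rw [← ENNReal.ofReal_toReal hCp]
        exact ENNReal.ofReal_le_ofReal (by simp)
end
end
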